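/- arXiv:math/0701214 — 8 statements merged into one kernel-verified Lean document; each statement's English description precedes it below -/
import Mathlib

section
/- Let F be a free group and let A₁, A₂ be finitely generated subgroups of F. Then for any elements g₁, g₂ ∈ F, the intersection A₁^{g₁} ∩ A₂^{g₂} of the conjugated subgroups is a finitely generated subgroup of F. -/
/-- The conjugate subgroup `A^g = {g⁻¹ a g : a ∈ A}`. -/
def Subgroup.conjugate {G : Type*} [Group G] (A : Subgroup G) (g : G) : Subgroup G :=
  A.map (MulAut.conj g⁻¹).toMonoidHom

theorem Subgroup.FG.conjugate {G : Type*} [Group G] {A : Subgroup G} (hA : A.FG) (g : G) :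
    (A.conjugate g).FG := by
  rw [Subgroup.fg_iff_submonoid_fg] at hA ⊢
  exact hA.map (MulAut.conj g⁻¹).toMonoidHom

namespace FreeGroup

variable {α : Type*}

/-- The letters of the word `w` lie in `X`, and each prefix of `w` represents an element of
`H * S`. In terms of the Schreier graph of `H`, the path spelled by `w` from the base point uses
only labels from `X` and vertices represented by `S`. -/
def IsTraced (H : Subgroup (FreeGroup α)) (S : Set (FreeGroup α)) (X : Set α)
    (w : List (α × Bool)) : Prop :=
  (∀ l₁ l₂, w = l₁ ++ l₂ → ∃ s ∈ S, mk l₁ * s⁻¹ ∈ H) ∧ ∀ x ∈ w, x.1 ∈ X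

namespace IsTraced

variable {H : Subgroup (FreeGroup α)} {S : Set (FreeGroup α)} {X : Set α}
  {v w : List (α × Bool)}

theorem nil (hS : (1 : FreeGroup α) ∈ S) : IsTraced H S X [] := by
  refine ⟨fun l₁ l₂ h => ⟨1, hS, ?_⟩, by simp⟩
  obtain ⟨rfl, rfl⟩ := List.append_eq_nil_iff.1 h.symm
  simp [← one_eq_mk]

theorem append (hv : IsTraced H S X v) (hw : IsTraced H S X w) (hvH : mk v ∈ H) :
    IsTraced H S X (v ++ w) := by
  refine ⟨fun l₁ l₂ h => ?_, fun x hx => (List.mem_append.1 hx).elim (hv.2 x) (hw.2 x)⟩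
  rcases List.append_eq_append_iff.1 h with ⟨a, rfl, ha⟩ | ⟨a, ha, -⟩
  · obtain ⟨s, hs, h'⟩ := hw.1 _ _ ha
    refine ⟨s, hs, ?_⟩
    rw [← mul_mk, mul_assoc]
    exact H.mul_mem hvH h'
  · exact hv.1 _ _ ha

theorem invRev (hw : IsTraced H S X w) (hwH : mk w ∈ H) :
    IsTraced H S X (FreeGroup.invRev w) := by
  constructor
  · intro l₁ l₂ h
    have h' : w = FreeGroup.invRev l₂ ++ FreeGroup.invRev l₁ := by
      rw [← invRev_append, ← h, invRev_invRev]
    obtain ⟨s, hs, hsH⟩ := hw.1 _ _ h'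
    refine ⟨s, hs, ?_⟩
    convert H.mul_mem (H.inv_mem hwH) hsH using 1
    rw [h', ← mul_mk, ← inv_mk, ← inv_mk]
    group
  · intro x hx
    simp only [FreeGroup.invRev, List.mem_reverse, List.mem_map] at hx
    obtain ⟨y, hy, rfl⟩ := hx
    exact hw.2 y hy

theorem step (hv : IsTraced H S X v) (h : Red.Step v w) : IsTraced H S X w := by
  obtain @⟨L₁, L₂, x, b⟩ := h
  refine ⟨fun l₁ l₂ h => ?_, fun y hy => hv.2 y (by simp at hy ⊢; tauto)⟩
  rcases List.append_eq_append_iff.1 h with ⟨a, rfl, ha⟩ | ⟨a, rfl, -⟩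
  · obtain ⟨s, hs, h'⟩ := hv.1 (L₁ ++ (x, b) :: (x, !b) :: a) l₂ (by simp [ha])
    refine ⟨s, hs, ?_⟩
    have e : mk (L₁ ++ (x, b) :: (x, !b) :: a) = mk (L₁ ++ a) := Quot.sound Red.Step.not
    rwa [e] at h'
  · exact hv.1 l₁ (a ++ (x, b) :: (x, !b) :: L₂) (by simp)

theorem red (hv : IsTraced H S X v) (h : Red v w) : IsTraced H S X w := by
  induction h with
  | refl => exact hv
  | tail _ h ih => exact ih.step h

end IsTraced

/-- A finitely generated subgroup of a free group is quasiconvex: the reduced words of its elements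
trace paths in a finite part of its Schreier graph. -/
theorem exists_finite_isTraced_of_fg {H : Subgroup (FreeGroup α)} (hH : H.FG) :
    ∃ (S : Set (FreeGroup α)) (X : Set α), S.Finite ∧ X.Finite ∧
      ∀ w, mk w ∈ H → IsReduced w → IsTraced H S X w := by
  classical
  obtain ⟨T, rfl⟩ := hH
  let S : Set (FreeGroup α) :=
    insert 1 (⋃ t ∈ T, {g | g ∈ (t.toWord.inits.map mk : List (FreeGroup α))})
  let X : Set α := ⋃ t ∈ T, {x | x ∈ t.toWord.map Prod.fst}
  refine ⟨S, X, (T.finite_toSet.biUnion fun t _ => List.finite_toSet _).insert 1,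
    T.finite_toSet.biUnion fun t _ => List.finite_toSet _, ?_⟩
  have key : ∀ h ∈ Subgroup.closure (T : Set (FreeGroup α)),
      ∃ w, mk w = h ∧ IsTraced (Subgroup.closure (T : Set (FreeGroup α))) S X w := by
    intro h hh
    induction hh using Subgroup.closure_induction with
    | mem t ht =>
      refine ⟨t.toWord, mk_toWord, fun l₁ l₂ h => ⟨mk l₁, Or.inr ?_, by simp [-inv_mk]⟩, fun x hx => ?_⟩
      · exact Set.mem_biUnion ht
          (List.mem_map_of_mem ((List.mem_inits _ _).2 (h ▸ List.prefix_append l₁ l₂)))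
      · exact Set.mem_biUnion ht (List.mem_map_of_mem hx)
    | one => exact ⟨[], rfl, IsTraced.nil (Set.mem_insert _ _)⟩
    | mul x y hx hy ihx ihy =>
      obtain ⟨v, rfl, hv⟩ := ihx
      obtain ⟨w, rfl, hw⟩ := ihy
      exact ⟨v ++ w, mul_mk.symm, hv.append hw hx⟩
    | inv x hx ih =>
      obtain ⟨w, rfl, hw⟩ := ih
      exact ⟨invRev w, inv_mk.symm, hw.invRev hx⟩
  intro w hwH hw
  obtain ⟨v, hvw, hv⟩ := key _ hwH
  have h := hv.red (reduce.red (L := v))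
  rwa [reduce.sound hvw, hw.reduce_eq] at h

/-- A subgroup of a free group whose elements are spelled by words tracing paths in a finite part of
its Schreier graph is finitely generated. -/
theorem fg_of_forall_exists_isTraced {H : Subgroup (FreeGroup α)} {S : Set (FreeGroup α)}
    {X : Set α} (hS : S.Finite) (hX : X.Finite)
    (h : ∀ g ∈ H, ∃ w, mk w = g ∧ IsTraced H S X w) : H.FG := by
  let E : Set (FreeGroup α) :=
    (fun q : (FreeGroup α × FreeGroup α) × (α × Bool) => q.1.1 * mk [q.2] * q.1.2⁻¹) ''
      ((S ×ˢ S) ×ˢ (X ×ˢ Set.univ))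
  let G : Set (FreeGroup α) := (S ∪ E) ∩ H
  have hG : G.Finite :=
    (hS.union (((hS.prod hS).prod (hX.prod Set.finite_univ)).image _)).inter_of_left _
  refine (Subgroup.fg_iff H).2 ⟨G, le_antisymm ((Subgroup.closure_le H).2 fun g hg => hg.2) ?_, hG⟩
  intro g hg
  obtain ⟨w, rfl, hw⟩ := h g hg
  have key : ∀ l₁ l₂, w = l₁ ++ l₂ → ∀ s ∈ S, mk l₁ * s⁻¹ ∈ H →
      mk l₁ * s⁻¹ ∈ Subgroup.closure G := by
    intro l₁
    induction l₁ using List.reverseRecOn with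
    | nil =>
      intro l₂ _ s hs hsH
      rw [← one_eq_mk, one_mul] at hsH ⊢
      exact inv_mem (Subgroup.subset_closure ⟨Or.inl hs, inv_mem_iff.1 hsH⟩)
    | append_singleton l x ih =>
      intro l₂ hl s hs hsH
      have hl' : w = l ++ (x :: l₂) := by simpa using hl
      obtain ⟨t, ht, htH⟩ := hw.1 _ _ hl'
      have hx : x.1 ∈ X := hw.2 x (by simp [hl'])
      have e : mk (l ++ [x]) * s⁻¹ = (mk l * t⁻¹) * (t * mk [x] * s⁻¹) := by
        rw [← mul_mk]
        group
      rw [e] at hsH ⊢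
      exact mul_mem (ih _ hl' t ht htH) (Subgroup.subset_closure
        ⟨Or.inr ⟨((t, s), x), ⟨⟨ht, hs⟩, hx, trivial⟩, rfl⟩, (H.mul_mem_cancel_left htH).1 hsH⟩)
  obtain ⟨s, hs, hsH⟩ := hw.1 w [] (by simp)
  have hs' : s ∈ Subgroup.closure G :=
    Subgroup.subset_closure ⟨Or.inl hs, inv_mem_iff.1 ((H.mul_mem_cancel_left hg).1 hsH)⟩
  simpa using mul_mem (key w [] (by simp) s hs hsH) hs'

/-- Howson's theorem: the intersection of two finitely generated subgroups of a free group is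
finitely generated. -/
theorem fg_inf {H K : Subgroup (FreeGroup α)} (hH : H.FG) (hK : K.FG) : (H ⊓ K).FG := by
  classical
  obtain ⟨S, X, hS, hX, h⟩ := exists_finite_isTraced_of_fg hH
  obtain ⟨T, _, hT, -, k⟩ := exists_finite_isTraced_of_fg hK
  have hr : ∀ q : FreeGroup α × FreeGroup α, ∃ r, ∀ p, p * q.1⁻¹ ∈ H → p * q.2⁻¹ ∈ K →
      p * r⁻¹ ∈ H ⊓ K := by
    intro q
    by_cases hq : ∃ r, r * q.1⁻¹ ∈ H ∧ r * q.2⁻¹ ∈ K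
    · obtain ⟨r, hrH, hrK⟩ := hq
      exact ⟨r, fun p hpH hpK => ⟨by simpa using mul_mem hpH (inv_mem hrH),
        by simpa using mul_mem hpK (inv_mem hrK)⟩⟩
    · exact ⟨1, fun p hpH hpK => (hq ⟨p, hpH, hpK⟩).elim⟩
  choose r hr using hr
  refine fg_of_forall_exists_isTraced ((hS.prod hT).image r) hX fun g hg =>
    ⟨g.toWord, mk_toWord, fun l₁ l₂ hl => ?_, ?_⟩
  · obtain ⟨s, hs, hsH⟩ := (h g.toWord (by rw [mk_toWord]; exact hg.1) isReduced_toWord).1 _ _ hl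
    obtain ⟨t, ht, htK⟩ := (k g.toWord (by rw [mk_toWord]; exact hg.2) isReduced_toWord).1 _ _ hl
    exact ⟨r (s, t), ⟨(s, t), ⟨hs, ht⟩, rfl⟩, hr (s, t) _ hsH htK⟩
  · exact (h g.toWord (by rw [mk_toWord]; exact hg.1) isReduced_toWord).2

end FreeGroup

/-- (Howson) In a free group, the intersection of conjugates of two finitely
generated subgroups is finitely generated. -/
theorem fg_inf_conjugate {α : Type*} (A₁ A₂ : Subgroup (FreeGroup α))
    (h₁ : A₁.FG) (h₂ : A₂.FG) (g₁ g₂ : FreeGroup α) :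
    (A₁.conjugate g₁ ⊓ A₂.conjugate g₂).FG := by
  exact FreeGroup.fg_inf (h₁.conjugate g₁) (h₂.conjugate g₂)
end

section
/- Let F be a free group and let A, B be finitely generated subgroups of F. Then the intersection A ∩ B is a finitely generated subgroup of F. -/
theorem List.prefix_or_exists_of_prefix_append {β : Type*} {P L₁ L₂ : List β}
    (h : P <+: L₁ ++ L₂) : P <+: L₁ ∨ ∃ Q, P = L₁ ++ Q ∧ Q <+: L₂ := by
  obtain ⟨R, hR⟩ := h
  rcases List.append_eq_append_iff.1 hR with ⟨Q, hQ, -⟩ | ⟨Q, hQ, hQ'⟩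
  · exact Or.inl ⟨Q, hQ.symm⟩
  · exact Or.inr ⟨Q, hQ, R, hQ'.symm⟩

namespace FreeGroup

variable {α : Type*}

/-- Every prefix of the word `L` represents an element of `H * S`. -/
def PrefixesNear (H : Subgroup (FreeGroup α)) (S : Set (FreeGroup α))
    (L : List (α × Bool)) : Prop :=
  ∀ P, P <+: L → ∃ s ∈ S, mk P * s⁻¹ ∈ H

namespace PrefixesNear

variable {H : Subgroup (FreeGroup α)} {S : Set (FreeGroup α)} {L L' : List (α × Bool)}

theorem nil (hS : 1 ∈ S) : PrefixesNear H S [] := by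
  intro P hP
  rw [List.prefix_nil] at hP
  subst hP
  exact ⟨1, hS, by simp [← one_eq_mk]⟩

theorem step (h : PrefixesNear H S L) (hL : Red.Step L L') : PrefixesNear H S L' := by
  obtain @⟨L₁, L₂, x, b⟩ := hL
  intro P hP
  rcases List.prefix_or_exists_of_prefix_append hP with hP | ⟨Q, rfl, hQ⟩
  · exact h P (hP.trans (List.prefix_append _ _))
  · have := h (L₁ ++ (x, b) :: (x, !b) :: Q) (by simpa using hQ)
    have eq : mk (L₁ ++ (x, b) :: (x, !b) :: Q) = mk (L₁ ++ Q) := Quot.sound Red.Step.not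
    rwa [eq] at this

theorem red (h : PrefixesNear H S L) (hL : Red L L') : PrefixesNear H S L' := by
  induction hL with
  | refl => exact h
  | tail _ hs ih => exact ih.step hs

theorem append (h : PrefixesNear H S L) (hL : mk L ∈ H) (h' : PrefixesNear H S L') :
    PrefixesNear H S (L ++ L') := by
  intro P hP
  rcases List.prefix_or_exists_of_prefix_append hP with hP | ⟨Q, rfl, hQ⟩
  · exact h P hP
  · obtain ⟨s, hs, hs'⟩ := h' Q hQ
    exact ⟨s, hs, by rw [← mul_mk, mul_assoc]; exact H.mul_mem hL hs'⟩

theorem invRev (h : PrefixesNear H S L) (hL : mk L ∈ H) :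
    PrefixesNear H S (FreeGroup.invRev L) := by
  rintro P ⟨Q, hQ⟩
  have hL' : L = FreeGroup.invRev Q ++ FreeGroup.invRev P := by
    rw [← invRev_invRev (L₁ := L), ← hQ, invRev_append]
  obtain ⟨s, hs, hs'⟩ := h (FreeGroup.invRev Q) ⟨_, hL'.symm⟩
  refine ⟨s, hs, ?_⟩
  have key : mk P = (mk L)⁻¹ * mk (FreeGroup.invRev Q) := by
    rw [hL', ← mul_mk, ← inv_mk, ← inv_mk]
    group
  rw [key, mul_assoc]
  exact H.mul_mem (H.inv_mem hL) hs'

end PrefixesNear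

/-- The reduced words of elements of a finitely generated subgroup `H` stay near `H` and use
finitely many letters. -/
theorem exists_finite_prefixesNear_of_fg [DecidableEq α] {H : Subgroup (FreeGroup α)}
    (hH : H.FG) :
    ∃ S : Set (FreeGroup α), S.Finite ∧ ∃ T : Set α, T.Finite ∧ ∀ h ∈ H,
      PrefixesNear H S h.toWord ∧ ∀ x ∈ h.toWord, x.1 ∈ T := by
  obtain ⟨X, rfl⟩ := hH
  refine ⟨insert 1 (⋃ g ∈ X, mk '' {P | P ∈ g.toWord.inits}),
    (X.finite_toSet.biUnion fun g _ => (List.finite_toSet _).image _).insert 1,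
    ⋃ g ∈ X, Prod.fst '' {x | x ∈ g.toWord},
    X.finite_toSet.biUnion fun g _ => (List.finite_toSet _).image _, fun h hh => ?_⟩
  induction hh using Subgroup.closure_induction with
  | mem g hg =>
    refine ⟨fun P hP => ⟨mk P, Or.inr ?_, by rw [mul_inv_cancel]; exact Subgroup.one_mem _⟩, fun x hx => ?_⟩
    · exact Set.mem_biUnion hg ⟨P, (List.mem_inits _ _).2 hP, rfl⟩
    · exact Set.mem_biUnion hg ⟨x, hx, rfl⟩
  | one => exact ⟨by simpa using PrefixesNear.nil (Set.mem_insert _ _), by simp⟩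
  | mul a b ha hb iha ihb =>
    rw [toWord_mul]
    refine ⟨(iha.1.append (by rwa [mk_toWord]) ihb.1).red reduce.red, fun x hx => ?_⟩
    rcases List.mem_append.1 (reduce.red.sublist.subset hx) with hx | hx
    exacts [iha.2 x hx, ihb.2 x hx]
  | inv a ha iha =>
    rw [toWord_inv]
    refine ⟨iha.1.invRev (by rwa [mk_toWord]), fun x hx => ?_⟩
    simp only [FreeGroup.invRev, List.mem_reverse, List.mem_map] at hx
    obtain ⟨y, hy, rfl⟩ := hx
    exact iha.2 y hy

/-- A subgroup `H` is finitely generated if the reduced words of its elements stay near `H` and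
use finitely many letters. -/
theorem fg_of_prefixesNear [DecidableEq α] {H : Subgroup (FreeGroup α)}
    {S : Set (FreeGroup α)} (hS : S.Finite) {T : Set α} (hT : T.Finite)
    (h : ∀ g ∈ H, PrefixesNear H S g.toWord ∧ ∀ x ∈ g.toWord, x.1 ∈ T) : H.FG := by
  let S' := insert 1 S
  let Y : Set (FreeGroup α) := (fun x => mk [x]) '' (T ×ˢ Set.univ)
  let X : Set (FreeGroup α) :=
    (S' ∪ Set.image2 (· * ·) S' (Set.image2 (fun y t => y * t⁻¹) Y S')) ∩ H
  have hS' : S'.Finite := hS.insert 1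
  have hY : Y.Finite := (hT.prod Set.finite_univ).image _
  have hX : X.Finite := (hS'.union (hS'.image2 _ (hY.image2 _ hS'))).inter_of_left _
  refine (Subgroup.fg_iff H).2 ⟨X, le_antisymm ?_ ?_, hX⟩
  · exact (Subgroup.closure_le H).2 Set.inter_subset_right
  intro g hg
  have hXH : Subgroup.closure X ≤ H := (Subgroup.closure_le H).2 Set.inter_subset_right
  have key : ∀ P, P <+: g.toWord → ∃ s ∈ S', mk P * s⁻¹ ∈ Subgroup.closure X := by
    intro P
    induction P using List.reverseRecOn with
    | nil => exact fun _ => ⟨1, Set.mem_insert _ _, by simp [← one_eq_mk]⟩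
    | append_singleton P x ih =>
      intro hP
      obtain ⟨s, hs, hs'⟩ := ih ((List.prefix_append _ _).trans hP)
      obtain ⟨t, ht, ht'⟩ := (h g hg).1 _ hP
      have hx : x.1 ∈ T := (h g hg).2 x (hP.subset (by simp))
      have ht : t ∈ S' := Set.mem_insert_of_mem _ ht
      have eq : mk (P ++ [x]) * t⁻¹ = mk P * s⁻¹ * (s * (mk [x] * t⁻¹)) := by
        rw [← mul_mk]; group
      refine ⟨t, ht, ?_⟩
      rw [eq] at ht' ⊢
      refine Subgroup.mul_mem _ hs' (Subgroup.subset_closure ⟨Or.inr ?_, ?_⟩)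
      · exact ⟨s, hs, _, ⟨_, ⟨x, ⟨hx, trivial⟩, rfl⟩, t, ht, rfl⟩, rfl⟩
      · exact (H.mul_mem_cancel_left (hXH hs')).1 ht'
  obtain ⟨s, hs, hs'⟩ := key _ (List.prefix_refl _)
  rw [mk_toWord] at hs'
  have hsH : s ∈ H := by simpa using (H.mul_mem_cancel_left hg).1 (hXH hs')
  simpa using Subgroup.mul_mem _ hs' (Subgroup.subset_closure (k := X) ⟨Or.inl hs, hsH⟩)

/-- Words that stay near `A` and near `B` stay near `A ⊓ B`. -/
theorem exists_finite_prefixesNear_inf (A B : Subgroup (FreeGroup α))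
    {S T : Set (FreeGroup α)} (hS : S.Finite) (hT : T.Finite) :
    ∃ R : Set (FreeGroup α), R.Finite ∧
      ∀ L, PrefixesNear A S L → PrefixesNear B T L → PrefixesNear (A ⊓ B) R L := by
  have hr : ∀ s t : FreeGroup α, ∃ r, ∀ p, p * s⁻¹ ∈ A → p * t⁻¹ ∈ B → p * r⁻¹ ∈ A ⊓ B := by
    intro s t
    by_cases hst : ∃ r, r * s⁻¹ ∈ A ∧ r * t⁻¹ ∈ B
    · obtain ⟨r, hrA, hrB⟩ := hst
      refine ⟨r, fun p hpA hpB => ⟨?_, ?_⟩⟩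
      · simpa using A.mul_mem hpA (A.inv_mem hrA)
      · simpa using B.mul_mem hpB (B.inv_mem hrB)
    · exact ⟨1, fun p hpA hpB => (hst ⟨p, hpA, hpB⟩).elim⟩
  choose r hr using hr
  refine ⟨Set.image2 r S T, hS.image2 r hT, fun L hA hB P hP => ?_⟩
  obtain ⟨s, hs, hs'⟩ := hA P hP
  obtain ⟨t, ht, ht'⟩ := hB P hP
  exact ⟨r s t, ⟨s, hs, t, ht, rfl⟩, hr s t _ hs' ht'⟩

end FreeGroup

/-- (Howson) In a free group, the intersection of two finitely generated
subgroups is finitely generated. -/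
theorem fg_inf_of_fg {α : Type*} (A B : Subgroup (FreeGroup α))
    (hA : A.FG) (hB : B.FG) : (A ⊓ B).FG := by
  classical
  obtain ⟨S, hS, U, hU, hSU⟩ := FreeGroup.exists_finite_prefixesNear_of_fg hA
  obtain ⟨T, hT, _, _, hTV⟩ := FreeGroup.exists_finite_prefixesNear_of_fg hB
  obtain ⟨R, hR, hRL⟩ := FreeGroup.exists_finite_prefixesNear_inf A B hS hT
  exact FreeGroup.fg_of_prefixesNear hR hU fun g hg =>
    ⟨hRL _ (hSU g hg.1).1 (hTV g hg.2).1, (hSU g hg.1).2⟩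
end

section
/- Let F be a nonabelian free group and let A be a finitely generated subgroup of F such that every subgroup B of F with A ≤ B is finitely generated (i.e., A is contained in no subgroup of infinite rank). Then A has finite index in F. -/
lemma QuotientGroup.smul_mk_one {G : Type*} [Group G] (K : Subgroup G) (g : G) :
    g • ((1 : G) : G ⧸ K) = (g : G ⧸ K) := by
  rw [MulAction.Quotient.smul_coe, smul_eq_mul, mul_one]

namespace FreeGroup

variable {α : Type*}

/-- A free group acting on `X` has a 1-cocycle with values in functions `X → L` taking
arbitrary prescribed values on the generators. -/
lemma exists_cocycle {X L : Type*} [MulAction (FreeGroup α) X] [AddCommGroup L]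
    (e : α → X → L) :
    ∃ C : FreeGroup α → X → L, (∀ a x, C (of a) x = e a x) ∧
      ∀ u v x, C (u * v) x = C u (v • x) + C v x := by
  let σ : α → Equiv.Perm (X × L) := fun a =>
    { toFun := fun p => (of a • p.1, p.2 + e a p.1)
      invFun := fun p => ((of a)⁻¹ • p.1, p.2 - e a ((of a)⁻¹ • p.1))
      left_inv := fun p => by simp
      right_inv := fun p => by simp }
  let ρ : FreeGroup α →* Equiv.Perm (X × L) := lift σ
  have hρ (w : FreeGroup α) : ∀ x t, ρ w (x, t) = (w • x, t + (ρ w (x, 0)).2) := by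
    induction w using FreeGroup.induction_on with
    | C1 => simp
    | of a => intro x t; simp [ρ, σ]
    | inv_of a _ => intro x t; simp [ρ, σ, Equiv.Perm.inv_def, sub_eq_add_neg]
    | mul u v hu hv =>
      intro x t
      rw [_root_.map_mul, Equiv.Perm.mul_apply, Equiv.Perm.mul_apply, hv x t, hv x 0, hu, hu _ (0 + _)]
      simp [mul_smul, add_assoc]
  refine ⟨fun w x => (ρ w (x, 0)).2, fun a x => by simp [ρ, σ], fun u v x => ?_⟩
  dsimp only
  rw [_root_.map_mul, Equiv.Perm.mul_apply, hρ v, hρ u]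
  simp [add_comm]

/-- A finite index subgroup of a nonabelian free group needs at least as many generators as its
index. -/
lemma index_le_card_of_closure_eq [Nontrivial α] (K : Subgroup (FreeGroup α)) [K.FiniteIndex]
    (S : Finset (FreeGroup α)) (hS : Subgroup.closure (S : Set (FreeGroup α)) = K) :
    K.index ≤ S.card := by
  classical
  obtain ⟨a₀, a₁, hne⟩ := exists_pair_ne α
  let X := FreeGroup α ⧸ K
  let L := Bool × X → ℚ
  have : Fintype X := Fintype.ofFinite X
  obtain ⟨C, hCe, hC⟩ := exists_cocycle (X := X) (L := L)
    (fun a x => Pi.single (decide (a = a₀), x) 1)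
  let x₀ : X := ((1 : FreeGroup α) : X)
  have hC1 (x : X) : C 1 x = 0 := by simpa using hC 1 1 x
  have hK (k : FreeGroup α) (hk : k ∈ K) : k • x₀ = x₀ := by
    rw [QuotientGroup.smul_mk_one, QuotientGroup.eq]
    simpa using hk
  let W : Finset L := S.image (C · x₀) ∪ Finset.univ.image fun x : X => C x.out x₀
  let V : Submodule ℚ L := Submodule.span ℚ W
  have hKV (k : FreeGroup α) (hk : k ∈ K) : C k x₀ ∈ V := by
    rw [← hS] at hk
    induction hk using Subgroup.closure_induction with
    | mem s hs =>
      exact Submodule.subset_span (Finset.mem_union_left _ (Finset.mem_image_of_mem _ hs))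
    | one => simp [hC1]
    | mul u v _ hv hu' hv' =>
      rw [hC, hK v (hS ▸ hv)]
      exact V.add_mem hu' hv'
    | inv u hu hu' =>
      have := hC u⁻¹ u x₀
      rw [hK u (hS ▸ hu), inv_mul_cancel, hC1] at this
      rw [eq_neg_of_add_eq_zero_left this.symm]
      exact V.neg_mem hu'
  have hV (w : FreeGroup α) : C w x₀ ∈ V := by
    have hk : (w : X).out⁻¹ * w ∈ K := by
      rw [← QuotientGroup.eq, QuotientGroup.out_eq']
    have := hC (w : X).out ((w : X).out⁻¹ * w) x₀
    rw [mul_inv_cancel_left, hK _ hk] at this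
    rw [this]
    exact V.add_mem (Submodule.subset_span (Finset.mem_union_right _
      (Finset.mem_image_of_mem _ (Finset.mem_univ _)))) (hKV _ hk)
  have hgen (a : α) (x : X) : (Pi.single (decide (a = a₀), x) 1 : L) ∈ V := by
    obtain ⟨w, rfl⟩ := QuotientGroup.mk_surjective x
    have hw : w • x₀ = (w : X) := QuotientGroup.smul_mk_one K w
    have := hC (of a) w x₀
    rw [hw, hCe] at this
    rw [← sub_eq_of_eq_add this]
    exact V.sub_mem (hV _) (hV _)
  have htop : V = ⊤ := by
    rw [eq_top_iff, ← (Pi.basisFun ℚ (Bool × X)).span_eq, Submodule.span_le]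
    rintro _ ⟨⟨b, x⟩, rfl⟩
    rw [Pi.basisFun_apply]
    cases b
    · simpa [hne.symm] using hgen a₁ x
    · simpa using hgen a₀ x
  have hcard := finrank_span_finset_le_card (R := ℚ) W
  rw [Set.finrank, show (Submodule.span ℚ (W : Set L)) = ⊤ from htop, finrank_top,
    Module.finrank_fintype_fun_eq_card, Fintype.card_prod, Fintype.card_bool] at hcard
  have h1 : W.card ≤ S.card + Fintype.card X :=
    (Finset.card_union_le _ _).trans (add_le_add Finset.card_image_le Finset.card_image_le)
  have h2 : K.index = Fintype.card X := by
    rw [Subgroup.index, Nat.card_eq_fintype_card]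
  lia

/-- The action of `w` on `x` is determined by a finite part of the Schreier graph. -/
lemma exists_finset_forall_smul_eq {X : Type*} [MulAction (FreeGroup α) X] (w : FreeGroup α) :
    ∀ x : X, ∃ T₀ : Finset X, ∀ T : Finset X, T₀ ⊆ T → ∀ ρ : FreeGroup α →* Equiv.Perm T,
      (∀ a (t : T), of a • (t : X) ∈ T → (ρ (of a) t : X) = of a • (t : X)) →
      ∀ t : T, (t : X) = x → (ρ w t : X) = w • x := by
  classical
  induction w using FreeGroup.induction_on with
  | C1 => exact fun x => ⟨∅, fun T _ ρ _ t ht => by simpa using ht⟩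
  | of a =>
    refine fun x => ⟨{of a • x}, fun T hT ρ hρ t ht => ?_⟩
    subst ht
    exact hρ a t (hT (by simp))
  | inv_of a _ =>
    refine fun x => ⟨{(of a)⁻¹ • x}, fun T hT ρ hρ t ht => ?_⟩
    subst ht
    have hmem : (of a)⁻¹ • (t : X) ∈ T := hT (by simp)
    have h1 : ρ (of a) ⟨_, hmem⟩ = t := by
      ext
      rw [hρ a _ (by simp)]
      simp
    rw [_root_.map_inv, Equiv.Perm.inv_eq_iff_eq.mpr h1.symm]
  | mul u v hu hv =>
    intro x
    obtain ⟨T₁, h₁⟩ := hv x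
    obtain ⟨T₂, h₂⟩ := hu (v • x)
    refine ⟨T₁ ∪ T₂, fun T hT ρ hρ t ht => ?_⟩
    rw [_root_.map_mul, Equiv.Perm.mul_apply, mul_smul]
    exact h₂ T (Finset.union_subset_right hT) ρ hρ _
      (h₁ T (Finset.union_subset_left hT) ρ hρ t ht)

/-- The partial action of the generators of a free group on a finite subset of a `FreeGroup α`-set
extends to an action on that subset. -/
lemma exists_hom_perm_finset {X : Type*} [MulAction (FreeGroup α) X] (T : Finset X) :
    ∃ ρ : FreeGroup α →* Equiv.Perm T,
      ∀ a (t : T), of a • (t : X) ∈ T → (ρ (of a) t : X) = of a • (t : X) := by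
  classical
  have (a : α) : ∃ g : T ≃ T, ∀ t ∈ Finset.univ.filter fun t : T => of a • (t : X) ∈ T,
      (g t : X) = of a • (t : X) := by
    refine Finset.exists_equiv_extend_of_card_eq (by simp) ?_ ?_
    · intro y hy
      obtain ⟨t, ht, rfl⟩ := Finset.mem_image.1 hy
      exact (Finset.mem_filter.1 ht).2
    · intro s _ t _ hst
      exact Subtype.ext (MulAction.injective _ hst)
  choose g hg using this
  exact ⟨lift g, fun a t ht => by simpa using hg a t (by simpa using ht)⟩

/-- A finitely generated subgroup of infinite index in a free group is contained in subgroups of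
arbitrarily large finite index. -/
lemma exists_finiteIndex_le_index (M : Subgroup (FreeGroup α)) (hM : M.FG)
    (hind : ¬ M.FiniteIndex) (n : ℕ) :
    ∃ H : Subgroup (FreeGroup α), M ≤ H ∧ H.FiniteIndex ∧ n ≤ H.index := by
  classical
  obtain ⟨S, hS⟩ := hM
  let X := FreeGroup α ⧸ M
  have : Infinite X := by
    rw [← not_finite_iff_infinite]
    exact fun _ => hind Subgroup.finiteIndex_of_finite_quotient
  obtain ⟨R, hR⟩ := Infinite.exists_subset_card_eq X n
  let x₀ : X := ((1 : FreeGroup α) : X)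
  choose T₀ hT₀ using fun w : FreeGroup α => exists_finset_forall_smul_eq w x₀
  let T : Finset X := insert x₀ (S.biUnion T₀ ∪ R.biUnion fun x => T₀ x.out)
  obtain ⟨ρ, hρ⟩ := exists_hom_perm_finset (α := α) T
  let t₀ : T := ⟨x₀, Finset.mem_insert_self _ _⟩
  let _ : MulAction (FreeGroup α) T := MulAction.compHom T ρ
  have hsmul (w : FreeGroup α) (t : T) : w • t = ρ w t := rfl
  have hSρ (s : FreeGroup α) (hs : s ∈ S) : s • t₀ = t₀ := by
    ext
    rw [hsmul, hT₀ s T ((Finset.subset_biUnion_of_mem T₀ hs).trans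
      (Finset.subset_union_left.trans (Finset.subset_insert _ _))) ρ hρ t₀ rfl]
    have : s ∈ M := hS ▸ Subgroup.subset_closure hs
    rw [QuotientGroup.smul_mk_one, QuotientGroup.eq]
    simpa using this
  have hRρ (x : X) (hx : x ∈ R) : ((x.out • t₀ : T) : X) = x := by
    rw [hsmul, hT₀ x.out T ((Finset.subset_biUnion_of_mem (fun x : X => T₀ x.out) hx).trans
      (Finset.subset_union_right.trans (Finset.subset_insert _ _))) ρ hρ t₀ rfl]
    rw [QuotientGroup.smul_mk_one, QuotientGroup.out_eq']
  have hindex := MulAction.index_stabilizer (FreeGroup α) t₀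
  refine ⟨MulAction.stabilizer (FreeGroup α) t₀, ?_, ⟨?_⟩, ?_⟩
  · rw [← hS, Subgroup.closure_le]
    exact fun s hs => hSρ s hs
  · rw [hindex]
    exact ((Set.ncard_pos (Set.toFinite _)).2 (MulAction.nonempty_orbit t₀)).ne'
  · rw [hindex, ← hR, ← Set.ncard_coe_finset,
      ← Set.ncard_image_of_injective _ (Subtype.val_injective (p := (· ∈ T)))]
    refine Set.ncard_le_ncard (fun x hx => ⟨x.out • t₀, ⟨_, rfl⟩, hRρ x hx⟩) (Set.toFinite _)

/-- A finitely generated subgroup of infinite index in a nonabelian free group is properly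
contained in another subgroup of infinite index. -/
lemma exists_lt_not_finiteIndex [Nontrivial α] (M : Subgroup (FreeGroup α)) (hM : M.FG)
    (hind : ¬ M.FiniteIndex) :
    ∃ K : Subgroup (FreeGroup α), M < K ∧ ¬ K.FiniteIndex := by
  classical
  obtain ⟨S, hS⟩ := hM
  obtain ⟨H, hMH, hH, hn⟩ := exists_finiteIndex_le_index M ⟨S, hS⟩ hind (S.card + 2)
  obtain ⟨g, hgH, hgM⟩ := SetLike.exists_of_lt (hMH.lt_of_ne (by rintro rfl; exact hind hH))
  let K := Subgroup.closure ((insert g S : Finset (FreeGroup α)) : Set (FreeGroup α))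
  have hgK : g ∈ K := Subgroup.subset_closure (by simp)
  have hMK : M ≤ K := hS ▸ Subgroup.closure_mono (by simp)
  have hKH : K ≤ H := by
    rw [Subgroup.closure_le, Finset.coe_insert, Set.insert_subset_iff]
    exact ⟨hgH, (Subgroup.closure_le H).1 (hS.trans_le hMH)⟩
  refine ⟨K, hMK.lt_of_not_ge fun h => hgM (h hgK), fun hK => ?_⟩
  have h1 := index_le_card_of_closure_eq K _ rfl
  have h2 := Subgroup.index_antitone hKH
  have h3 := Finset.card_insert_le g S
  lia

end FreeGroup

/-- If every subgroup above `A` is finitely generated, then a subgroup of infinite index above `A`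
lies in a maximal one. -/
lemma Subgroup.exists_maximal_not_finiteIndex {G : Type*} [Group G] (A : Subgroup G)
    (h : ∀ B : Subgroup G, A ≤ B → B.FG) (hA : ¬ A.FiniteIndex) :
    ∃ M, A ≤ M ∧ Maximal (fun B : Subgroup G => A ≤ B ∧ ¬ B.FiniteIndex) M := by
  refine zorn_le_nonempty₀ {B : Subgroup G | A ≤ B ∧ ¬ B.FiniteIndex} ?_ A ⟨le_rfl, hA⟩
  intro c hc hchain y hy
  obtain ⟨S, hS⟩ := h (sSup c) ((hc hy).1.trans (le_sSup hy))
  have hsub : (S : Set G) ⊆ ⋃ B ∈ c, (B : Set G) := fun s hs => by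
    have : s ∈ sSup c := hS ▸ Subgroup.subset_closure hs
    simpa [Subgroup.mem_sSup_of_directedOn ⟨y, hy⟩ hchain.directedOn] using this
  obtain ⟨B, hB, hSB⟩ := DirectedOn.exists_mem_subset_of_finset_subset_biUnion ⟨y, hy⟩
    (f := fun B : Subgroup G => (B : Set G)) hchain.directedOn hsub
  exact ⟨B, hc hB, fun z hz => (le_sSup hz).trans (hS ▸ (Subgroup.closure_le B).2 hSB)⟩

/-- (Greenberg–Karrass) A finitely generated subgroup of a nonabelian free
group contained in no infinitely generated subgroup has finite index. -/
theorem finiteIndex_of_forall_fg {α : Type*} [Nontrivial α]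
    (A : Subgroup (FreeGroup α)) (hA : A.FG)
    (h : ∀ B : Subgroup (FreeGroup α), A ≤ B → B.FG) :
    A.FiniteIndex := by
  by_contra hind
  obtain ⟨M, hAM, hM⟩ := A.exists_maximal_not_finiteIndex h hind
  obtain ⟨K, hMK, hK⟩ := FreeGroup.exists_lt_not_finiteIndex M (h M hAM) hM.prop.2
  exact hMK.not_ge (hM.le_of_ge ⟨hAM.trans hMK.le, hK⟩ hMK.le)
end

section
/- Let F be a free group, let A be a finitely generated subgroup of F, and let N be a normal subgroup of F with N ≠ {1} and N ≤ A. Then A has finite index in F. -/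
theorem List.IsPrefix.of_append {β : Type*} {p l₁ l₂ : List β} (h : p <+: l₁ ++ l₂) :
    p <+: l₁ ∨ ∃ q, p = l₁ ++ q ∧ q <+: l₂ := by
  rcases List.prefix_or_prefix_of_prefix h (List.prefix_append l₁ l₂) with h' | ⟨q, rfl⟩
  · exact .inl h'
  · exact .inr ⟨q, rfl, (List.prefix_append_right_inj l₁).1 h⟩

namespace FreeGroup

variable {α : Type*}

theorem Red.exists_prefix_mk_eq {L₁ L₂ p : List (α × Bool)} (h : Red L₁ L₂) (hp : p <+: L₂) :
    ∃ q, q <+: L₁ ∧ mk q = mk p := by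
  induction h generalizing p with
  | refl => exact ⟨p, hp, rfl⟩
  | tail _ hstep ih =>
    obtain @⟨M₁, M₂, a, b⟩ := hstep
    rcases hp.of_append with hp | ⟨q, rfl, hq⟩
    · exact ih (hp.trans (List.prefix_append ..))
    · obtain ⟨r, hr, hrq⟩ := ih (p := M₁ ++ (a, b) :: (a, !b) :: q) <|
        (List.prefix_append_right_inj M₁).2 <| by simpa using hq
      exact ⟨r, hr, hrq.trans <| Quot.sound Red.Step.not⟩

theorem IsReduced.invRev {L : List (α × Bool)} (h : IsReduced L) : IsReduced (invRev L) := by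
  classical
  rw [isReduced_iff_reduce_eq] at h ⊢
  rw [reduce_invRev, h]

theorem IsCyclicallyReduced.invRev {L : List (α × Bool)} (h : IsCyclicallyReduced L) :
    IsCyclicallyReduced (invRev L) := by
  refine ⟨h.1.invRev, fun a ha b hb hab ↦ ?_⟩
  simp only [FreeGroup.invRev, List.getLast?_reverse, List.head?_map, List.head?_reverse,
    List.getLast?_map, Option.mem_def, Option.map_eq_some_iff] at ha hb
  obtain ⟨a, ha, rfl⟩ := ha
  obtain ⟨b, hb, rfl⟩ := hb
  simpa using (h.2 b hb a ha hab.symm).symm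

/-- A word can be extended on the right without cancellation by a cyclically reduced word
or by its formal inverse. -/
theorem IsReduced.append_or_append_invRev {u c : List (α × Bool)} (hu : IsReduced u)
    (hc : IsCyclicallyReduced c) : IsReduced (u ++ c) ∨ IsReduced (u ++ FreeGroup.invRev c) := by
  by_contra! hcon
  simp only [IsReduced, List.isChain_append, not_and, not_forall] at hcon hu
  obtain ⟨a, ha, b, hb, hab, hab'⟩ := hcon.1 hu hc.1
  obtain ⟨a', ha', d, hd, had, had'⟩ := hcon.2 hu hc.1.invRev
  obtain rfl : a = a' := Option.mem_unique ha ha'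
  simp only [FreeGroup.invRev, List.head?_reverse,
    List.getLast?_map, Option.mem_def, Option.map_eq_some_iff] at hd
  obtain ⟨d, hd, rfl⟩ := hd
  have := hc.2 d hd b hb (had.symm.trans hab)
  grind

/-- Multiplying a reduced word `u ++ v` on the right by a word no longer than `v` does not
affect `u`. -/
theorem prefix_reduce_append [DecidableEq α] {u v x : List (α × Bool)} (h : IsReduced (u ++ v))
    (hx : x.length ≤ v.length) : u <+: reduce (u ++ v ++ x) := by
  induction x generalizing v with
  | nil => simp [h.reduce_eq]
  | cons a x ih =>
    by_cases ha : IsReduced (u ++ (v ++ [a]))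
    · simpa using ih ha (by simp at hx ⊢; omega)
    · obtain rfl | ⟨v, b, rfl⟩ := v.eq_nil_or_concat'
      · simp at hx
      have hab : a = (b.1, !b.2) := by
        by_contra hne
        refine ha ?_
        rw [← List.append_assoc]
        refine List.IsChain.append h (by simp) ?_
        rw [← List.append_assoc]
        simp only [List.getLast?_append, List.getLast?_singleton]
        rintro _ ⟨⟩ _ ⟨⟩ h₁
        by_contra h₂
        exact hne (Prod.ext h₁.symm (Bool.eq_not.2 (Ne.symm h₂)))
      subst hab
      have hred : reduce (u ++ (v ++ [b]) ++ (b.1, !b.2) :: x) = reduce (u ++ v ++ x) := by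
        refine reduce.Step.eq ?_
        simpa using Red.Step.not (L₁ := u ++ v) (L₂ := x) (x := b.1) (b := b.2)
      rw [hred]
      exact ih (h.infix ⟨[], [b], by simp⟩) (by simp at hx ⊢; omega)

/-- A nontrivial normal subgroup contains the class of a nonempty cyclically reduced word. -/
theorem exists_isCyclicallyReduced_mem {N : Subgroup (FreeGroup α)} (hN : N.Normal)
    (hbot : N ≠ ⊥) : ∃ c : List (α × Bool), IsCyclicallyReduced c ∧ c ≠ [] ∧ mk c ∈ N := by
  classical
  obtain ⟨n, hn, hn1⟩ := N.bot_or_exists_ne_one.resolve_left hbot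
  have hconj := reduceCyclically.conj_conjugator_reduceCyclically n.toWord
  refine ⟨reduceCyclically n.toWord, reduceCyclically.isCyclicallyReduced isReduced_toWord,
    fun h ↦ hn1 ?_, ?_⟩
  · rw [← mk_toWord (x := n), ← hconj, h, ← mul_mk, ← mul_mk, ← inv_mk, ← one_eq_mk, mul_one]
    exact mul_inv_cancel _
  · rw [← mk_toWord (x := n), ← hconj, ← mul_mk, ← mul_mk, ← inv_mk] at hn
    simpa [mul_assoc, -mul_mk, -inv_mk] using
      hN.conj_mem _ hn (mk (reduceCyclically.conjugator n.toWord))⁻¹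

/-- Every reduced word is a prefix of the reduced word of some element of a given nontrivial
normal subgroup. -/
theorem exists_mem_toWord_prefix [DecidableEq α] {N : Subgroup (FreeGroup α)} (hN : N.Normal)
    (hbot : N ≠ ⊥) (w : FreeGroup α) : ∃ g ∈ N, w.toWord <+: g.toWord := by
  obtain ⟨c, hc, hne, hcN, hwc⟩ : ∃ c : List (α × Bool), IsCyclicallyReduced c ∧ c ≠ [] ∧
      mk c ∈ N ∧ IsReduced (w.toWord ++ c) := by
    obtain ⟨c, hc, hne, hcN⟩ := exists_isCyclicallyReduced_mem hN hbot
    rcases isReduced_toWord.append_or_append_invRev hc (u := w.toWord) with h | h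
    · exact ⟨c, hc, hne, hcN, h⟩
    · refine ⟨invRev c, hc.invRev, fun h0 ↦ hne ?_, by simpa using N.inv_mem hcN, h⟩
      rw [← invRev_invRev (L₁ := c), h0, invRev_empty]
  set k := w.toWord.length + 1
  refine ⟨w * mk c ^ k * w⁻¹, hN.conj_mem _ (N.pow_mem hcN k) w, ?_⟩
  have hred : IsReduced (w.toWord ++ (List.replicate k c).flatten) := by
    simpa using IsReduced.append_flatten_replicate_append (L₃ := []) hc (by simpa using hwc)
      (n := k) (by simp [k])
  have hword : w * mk c ^ k * w⁻¹ =
      mk (w.toWord ++ (List.replicate k c).flatten ++ invRev w.toWord) := by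
    rw [← mul_mk, ← mul_mk, ← inv_mk, mk_toWord, pow_mk]
  rw [hword, toWord_mk]
  refine prefix_reduce_append hred ?_
  have := List.length_pos_of_ne_nil hne
  simp only [invRev_length, List.length_flatten, List.map_replicate, List.sum_replicate, k,
    smul_eq_mul]
  nlinarith

/-- The vertices of the core graph of a finitely generated subgroup: finitely many cosets suffice
to cover all prefixes of reduced words representing its elements. -/
theorem exists_finite_prefix_cosets [DecidableEq α] {A : Subgroup (FreeGroup α)} (hA : A.FG) :
    ∃ C : Set (FreeGroup α), C.Finite ∧
      ∀ g ∈ A, ∀ p, p <+: g.toWord → ∃ q ∈ C, mk p * q⁻¹ ∈ A := by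
  obtain ⟨S, rfl⟩ := hA
  refine ⟨insert 1 (⋃ s ∈ S, Set.image mk {p | p ∈ s.toWord.inits}),
    .insert _ (S.finite_toSet.biUnion fun s _ ↦ (List.finite_toSet _).image _),
    fun g hg ↦ ?_⟩
  set A := Subgroup.closure (S : Set (FreeGroup α))
  set C := insert 1 (⋃ s ∈ S, Set.image mk {p | p ∈ s.toWord.inits})
  suffices ∃ L, mk L = g ∧ ∀ p, p <+: L → ∃ q ∈ C, mk p * q⁻¹ ∈ A by
    obtain ⟨L, rfl, hL⟩ := this
    intro p hp
    obtain ⟨q, hq, hqp⟩ := Red.exists_prefix_mk_eq (reduce.red (L := L)) (by simpa using hp)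
    exact hqp ▸ hL q hq
  induction hg using Subgroup.closure_induction with
  | mem s hs =>
    refine ⟨s.toWord, mk_toWord, fun p hp ↦ ⟨mk p, .inr ?_, by simp [-mul_mk, -inv_mk]⟩⟩
    exact Set.mem_biUnion hs ⟨p, by simpa using hp, rfl⟩
  | one =>
    refine ⟨[], rfl, fun p hp ↦ ⟨1, .inl rfl, ?_⟩⟩
    simp [List.prefix_nil.1 hp, ← one_eq_mk]
  | mul x y hx hy ihx ihy =>
    obtain ⟨L, rfl, hL⟩ := ihx
    obtain ⟨M, rfl, hM⟩ := ihy
    refine ⟨L ++ M, mul_mk.symm, fun p hp ↦ ?_⟩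
    rcases hp.of_append with h | ⟨p, rfl, h⟩
    · exact hL p h
    · obtain ⟨q, hq, hqA⟩ := hM p h
      exact ⟨q, hq, by simpa only [← mul_mk, mul_assoc] using mul_mem hx hqA⟩
  | inv x hx ihx =>
    obtain ⟨L, rfl, hL⟩ := ihx
    refine ⟨invRev L, inv_mk.symm, ?_⟩
    rintro p ⟨t, ht⟩
    have hLt : invRev t ++ invRev p = L := by rw [← invRev_append, ht, invRev_invRev]
    obtain ⟨q, hq, hqA⟩ := hL (invRev t) ⟨_, hLt⟩
    refine ⟨q, hq, ?_⟩
    rw [← hLt, ← mul_mk, ← inv_mk (L := p)] at hx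
    simpa [mul_assoc, -mul_mk, -inv_mk] using mul_mem (inv_mem hx) hqA

end FreeGroup

theorem Subgroup.finiteIndex_of_finite_cover {G : Type*} [Group G] {A : Subgroup G} {C : Set G}
    (hC : C.Finite) (h : ∀ w : G, ∃ q ∈ C, w * q⁻¹ ∈ A) : A.FiniteIndex := by
  have := hC.to_subtype
  have hsurj : Function.Surjective fun q : C ↦ ((q⁻¹ : G) : G ⧸ A) := by
    intro x
    obtain ⟨w, rfl⟩ := QuotientGroup.mk_surjective x
    obtain ⟨q, hq, hqA⟩ := h w⁻¹
    refine ⟨⟨q, hq⟩, QuotientGroup.eq.2 ?_⟩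
    simpa using A.inv_mem hqA
  have := Finite.of_surjective _ hsurj
  exact Subgroup.finiteIndex_of_finite_quotient

/-- (Greenberg) A finitely generated subgroup of a free group containing a
nontrivial normal subgroup of the whole group has finite index. -/
theorem finiteIndex_of_normal_le {α : Type*}
    (A N : Subgroup (FreeGroup α)) (hA : A.FG)
    (hN : N.Normal) (hNbot : N ≠ ⊥) (hNA : N ≤ A) :
    A.FiniteIndex := by
  classical
  obtain ⟨C, hC, hcover⟩ := FreeGroup.exists_finite_prefix_cosets hA
  refine Subgroup.finiteIndex_of_finite_cover hC fun w ↦ ?_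
  obtain ⟨g, hg, hwg⟩ := FreeGroup.exists_mem_toWord_prefix hN hNbot w
  simpa [FreeGroup.mk_toWord] using hcover g (hNA hg) _ hwg
end

section
/- Let F be a free group, let A be a finitely generated subgroup of F, and let g ∈ F with g ∉ A. Then there exists a subgroup G of F of finite index such that A ≤ G and g ∉ G. -/
/-- The partial bijection of a finite set `V` induced by the action of a group element extends to
a permutation of `V`. -/
theorem exists_perm_extending_smul {G X : Type*} [Group G] [MulAction G X] (V : Set X) [Finite V]
    (a : G) : ∃ σ : Equiv.Perm V, ∀ x : V, a • (x : X) ∈ V → (σ x : X) = a • (x : X) := by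
  classical
  let e : {x : V // a • (x : X) ∈ V} ≃ {x : V // a⁻¹ • (x : X) ∈ V} :=
    { toFun := fun x => ⟨⟨a • (x.1 : X), x.2⟩, by simp⟩
      invFun := fun x => ⟨⟨a⁻¹ • (x.1 : X), x.2⟩, by simp⟩
      left_inv := fun x => by simp
      right_inv := fun x => by simp }
  exact ⟨e.extendSubtype, fun x hx => by rw [e.extendSubtype_apply_of_mem x hx]; rfl⟩

/-- If permutations `σ a` of `V` extend the partial action of the generators, then the action of a
word through `σ` agrees with the original one on any point whose whole trajectory stays in `V`. -/
theorem FreeGroup.lift_perm_apply_eq_smul {α X : Type*} [MulAction (FreeGroup α) X] {V : Set X}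
    {σ : α → Equiv.Perm V}
    (hσ : ∀ a (x : V), FreeGroup.of a • (x : X) ∈ V → (σ a x : X) = FreeGroup.of a • (x : X))
    (x : V) (L : List (α × Bool)) (hL : ∀ L', L' <:+ L → FreeGroup.mk L' • (x : X) ∈ V) :
    (FreeGroup.lift σ (FreeGroup.mk L) x : X) = FreeGroup.mk L • (x : X) := by
  induction L with
  | nil => simp [← FreeGroup.one_eq_mk]
  | cons p L ih =>
    obtain ⟨a, b⟩ := p
    have ih := ih fun L' h => hL L' (h.trans (List.suffix_cons _ _))
    have hmem := hL _ List.suffix_rfl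
    have hcons : FreeGroup.mk ((a, b) :: L) = FreeGroup.mk [(a, b)] * FreeGroup.mk L := by
      simp
    rw [hcons, mul_smul, ← ih] at hmem ⊢
    rw [_root_.map_mul, Equiv.Perm.mul_apply]
    generalize FreeGroup.lift σ (FreeGroup.mk L) x = y at hmem
    cases b with
    | true =>
      change (FreeGroup.lift σ (FreeGroup.of a) y : X) = FreeGroup.of a • (y : X)
      rw [FreeGroup.lift_apply_of, hσ a y hmem]
    | false =>
      have hinv : FreeGroup.mk [(a, false)] = (FreeGroup.of a)⁻¹ := rfl
      rw [hinv] at hmem ⊢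
      have hz : σ a ⟨(FreeGroup.of a)⁻¹ • (y : X), hmem⟩ = y :=
        Subtype.ext (by rw [hσ a _ (by simp)]; simp)
      rw [_root_.map_inv, FreeGroup.lift_apply_of, Equiv.Perm.inv_eq_iff_eq.mpr hz.symm]

/-- (M. Hall) A finitely generated subgroup of a free group is closed in the
profinite topology: any element outside it can be separated by a finite-index
subgroup containing it. -/
theorem exists_finiteIndex_superset_not_mem {α : Type*}
    (A : Subgroup (FreeGroup α)) (hA : A.FG)
    (g : FreeGroup α) (hg : g ∉ A) :
    ∃ G : Subgroup (FreeGroup α), G.FiniteIndex ∧ A ≤ G ∧ g ∉ G := by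
  classical
  obtain ⟨S, rfl⟩ := hA
  set A := Subgroup.closure (S : Set (FreeGroup α))
  let o : FreeGroup α ⧸ A := ((1 : FreeGroup α) : FreeGroup α ⧸ A)
  let V : Set (FreeGroup α ⧸ A) :=
    ⋃ w ∈ insert g S, (fun L => FreeGroup.mk L • o) '' {L | L ∈ w.toWord.tails}
  have hV : V.Finite :=
    (Finset.finite_toSet (insert g S)).biUnion fun w _ => (List.finite_toSet _).image _
  have : Finite V := hV
  have hmem : ∀ w ∈ insert g S, ∀ L, L <:+ w.toWord → FreeGroup.mk L • o ∈ V :=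
    fun w hw L hL => Set.mem_biUnion hw ⟨L, (List.mem_tails _ _).mpr hL, rfl⟩
  have ho : o ∈ V := by
    simpa [← FreeGroup.one_eq_mk] using
      hmem g (Finset.mem_insert_self _ _) [] List.nil_suffix
  choose σ hσ using fun a : α => exists_perm_extending_smul V (FreeGroup.of a)
  have key : ∀ w ∈ insert g S,
      FreeGroup.lift σ w ⟨o, ho⟩ = ⟨o, ho⟩ ↔ w ∈ A := fun w hw => by
    have h := FreeGroup.lift_perm_apply_eq_smul hσ ⟨o, ho⟩ w.toWord (hmem w hw)
    rw [FreeGroup.mk_toWord] at h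
    rw [Subtype.ext_iff, h, ← MulAction.mem_stabilizer_iff, MulAction.stabilizer_quotient]
  refine ⟨(MulAction.stabilizer (Equiv.Perm V) (⟨o, ho⟩ : V)).comap (FreeGroup.lift σ),
    ⟨by rw [Subgroup.index_comap]; exact Subgroup.index_ne_zero_of_finite⟩,
    (Subgroup.closure_le _).mpr fun w hw => ?_, fun h => ?_⟩
  · exact (key w (Finset.mem_insert_of_mem hw)).mpr (Subgroup.subset_closure hw)
  · exact hg ((key g (Finset.mem_insert_self _ _)).mp h)
end

section
/- Let F be a free group, let X be a finite subset of F, and let A be a finitely generated subgroup of F disjoint from X (no element of X lies in A). Then there exists a subgroup G of F of finite index such that A ≤ G and G is disjoint from X (no element of X lies in G). -/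
/-- A permutation of a type agrees, wherever it does not leave a given finite set,
with some permutation of that finite set. -/
theorem exists_perm_finset_apply_eq {Ω : Type*} (S : Finset Ω) (g : Equiv.Perm Ω) :
    ∃ p : Equiv.Perm S, ∀ s : S, g s ∈ S → (p s : Ω) = g s := by
  classical
  let e : {s : S // g s ∈ S} ≃ {s : S // g.symm s ∈ S} :=
    { toFun := fun s => ⟨⟨g s.1, s.2⟩, by simp⟩
      invFun := fun s => ⟨⟨g.symm s.1, s.2⟩, by simp⟩
      left_inv := fun s => by simp
      right_inv := fun s => by simp }
  exact ⟨e.extendSubtype, fun s hs => by rw [e.extendSubtype_apply_of_mem s hs]; rfl⟩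

/-- If the permutations `p a` of a finite set `S` agree with the action of the generators of a
free group wherever the latter stay in `S`, then the induced action of a word on a point agrees
with the original one as long as the trajectory of the point stays in `S`. -/
theorem FreeGroup.lift_perm_mk_apply {α Ω : Type*} [MulAction (FreeGroup α) Ω] {S : Finset Ω}
    {p : α → Equiv.Perm S}
    (hp : ∀ a, ∀ s : S, FreeGroup.of a • (s : Ω) ∈ S → (p a s : Ω) = FreeGroup.of a • (s : Ω))
    (b : S) (L : List (α × Bool)) (hL : ∀ L' ∈ L.tails, FreeGroup.mk L' • (b : Ω) ∈ S) :
    (FreeGroup.lift p (FreeGroup.mk L) b : Ω) = FreeGroup.mk L • (b : Ω) := by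
  induction L with
  | nil => simp [← FreeGroup.one_eq_mk]
  | cons x L ih =>
    have ih' := ih fun L' h => hL L' (by simp_all)
    have hx := hL (x :: L) (by simp)
    have hmul : FreeGroup.mk (x :: L) = FreeGroup.mk [x] * FreeGroup.mk L := by simp
    rw [hmul, mul_smul] at hx
    rw [hmul, _root_.map_mul, Equiv.Perm.mul_apply, mul_smul]
    rw [← ih'] at hx ⊢
    generalize FreeGroup.lift p (FreeGroup.mk L) b = s at hx ⊢
    obtain ⟨a, _ | _⟩ := x
    · have hinv : FreeGroup.mk [(a, false)] = (FreeGroup.of a)⁻¹ := by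
        simp [FreeGroup.of, FreeGroup.invRev]
      rw [hinv] at hx ⊢
      rw [_root_.map_inv, FreeGroup.lift_apply_of]
      have h : p a ⟨_, hx⟩ = s := Subtype.ext <| by
        rw [hp a ⟨_, hx⟩ (by simp)]
        simp
      rw [Equiv.Perm.inv_eq_iff_eq.mpr h.symm]
    · change (FreeGroup.lift p (FreeGroup.of a) s : Ω) = FreeGroup.of a • (s : Ω)
      rw [FreeGroup.lift_apply_of]
      exact hp a s hx

/-- (M. Hall) A finitely generated subgroup of a free group disjoint from a
finite set is contained in a finite-index subgroup disjoint from that set. -/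
theorem exists_finiteIndex_superset_disjoint {α : Type*}
    (X : Finset (FreeGroup α)) (A : Subgroup (FreeGroup α)) (hA : A.FG)
    (hX : ∀ x ∈ X, x ∉ A) :
    ∃ G : Subgroup (FreeGroup α), G.FiniteIndex ∧ A ≤ G ∧ ∀ x ∈ X, x ∉ G := by
  classical
  obtain ⟨T, rfl⟩ := hA
  set A := Subgroup.closure (T : Set (FreeGroup α))
  let base : FreeGroup α ⧸ A := ((1 : FreeGroup α) : FreeGroup α ⧸ A)
  let S : Finset (FreeGroup α ⧸ A) := insert base
    ((T ∪ X).biUnion fun w => (w.toWord.tails.map fun L => FreeGroup.mk L • base).toFinset)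
  let b : S := ⟨base, Finset.mem_insert_self _ _⟩
  choose p hp using fun a : α =>
    exists_perm_finset_apply_eq S (MulAction.toPerm (FreeGroup.of a))
  have key : ∀ w ∈ T ∪ X, (FreeGroup.lift p w b = b ↔ w ∈ A) := fun w hw => by
    have h := FreeGroup.lift_perm_mk_apply hp b w.toWord fun L hL =>
      Finset.mem_insert_of_mem <| Finset.mem_biUnion.mpr
        ⟨w, hw, List.mem_toFinset.mpr (List.mem_map_of_mem hL)⟩
    rw [FreeGroup.mk_toWord] at h
    rw [Subtype.ext_iff, h]
    change w • base = base ↔ _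
    rw [← MulAction.mem_stabilizer_iff, MulAction.stabilizer_quotient]
  refine ⟨(MulAction.stabilizer (Equiv.Perm S) b).comap (FreeGroup.lift p),
    ⟨?_⟩, ?_, ?_⟩
  · rw [Subgroup.index_comap]
    exact Subgroup.FiniteIndex.index_ne_zero
  · exact (Subgroup.closure_le _).mpr fun t ht =>
      (key t (Finset.mem_union_left _ ht)).mpr (Subgroup.subset_closure ht)
  · exact fun x hx h => hX x hx ((key x (Finset.mem_union_right _ hx)).mp h)
end

section
/- Let F be a free group, let X be a finite subset of F, and let A be a finitely generated subgroup of F disjoint from X. Then there exist a subgroup G of F of finite index, disjoint from X, with A ≤ G, and a subgroup B of G such that A is a free factor of G with complement B: the homomorphism from the free product A ∗ B to G induced by the two inclusion maps A ↪ G and B ↪ G is an isomorphism (equivalently, is bijective). -/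
open Monoid

namespace SchreierGraph

open FreeGroup hiding map_one map_mul map_inv

variable {α ι P : Type*} [Group P]

/-- The action of a free group on `ι × P` in which a generator `a` moves `ι` by `σ a` and
multiplies the second coordinate over `v` by the label `c v a` of the edge leaving `v`. -/
def labelledAction (σ : α → Equiv.Perm ι) (c : ι → α → P) :
    FreeGroup α →* Equiv.Perm (ι × P) :=
  lift fun a => Equiv.prodShear (σ a) fun v => Equiv.mulLeft (c v a)

theorem labelledAction_of (σ : α → Equiv.Perm ι) (c : ι → α → P) (a : α) (x : ι × P) :
    labelledAction σ c (of a) x = (σ a x.1, c x.1 a * x.2) := by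
  simp [labelledAction]

theorem labelledAction_apply_fst (σ : α → Equiv.Perm ι) (c : ι → α → P) (g : FreeGroup α)
    (x : ι × P) : (labelledAction σ c g x).1 = lift σ g x.1 := by
  induction g using FreeGroup.induction_on generalizing x with
  | C1 => simp
  | of a => simp [labelledAction_of]
  | inv_of a h =>
    rw [map_inv, map_inv, Equiv.Perm.eq_inv_iff_eq, ← h, ← Equiv.Perm.mul_apply, mul_inv_cancel,
      Equiv.Perm.one_apply]
  | mul g h hg hh => simp [hg, hh]

theorem labelledAction_apply_mul_right (σ : α → Equiv.Perm ι) (c : ι → α → P)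
    (g : FreeGroup α) (x : ι × P) (q : P) :
    labelledAction σ c g (x.1, x.2 * q) =
      ((labelledAction σ c g x).1, (labelledAction σ c g x).2 * q) := by
  induction g using FreeGroup.induction_on generalizing x with
  | C1 => simp
  | of a => simp [labelledAction_of, mul_assoc]
  | inv_of a h =>
    rw [map_inv, Equiv.Perm.inv_eq_iff_eq, h, ← Equiv.Perm.mul_apply, mul_inv_cancel,
      Equiv.Perm.one_apply]
  | mul g h hg hh => simp [hg, hh]

/-- The subgroup of a free group fixing the point `b` when generators act through `σ`. -/
def fixing (σ : α → Equiv.Perm ι) (b : ι) : Subgroup (FreeGroup α) :=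
  (MulAction.stabilizer (Equiv.Perm ι) b).comap (lift σ)

theorem mem_fixing {σ : α → Equiv.Perm ι} {b : ι} {g : FreeGroup α} :
    g ∈ fixing σ b ↔ lift σ g b = b :=
  Iff.rfl

instance [Finite ι] (σ : α → Equiv.Perm ι) (b : ι) : (fixing σ b).FiniteIndex := by
  refine ⟨?_⟩
  rw [fixing, Subgroup.index_comap]
  exact Subgroup.FiniteIndex.index_ne_zero
    (H := (MulAction.stabilizer (Equiv.Perm ι) b).subgroupOf _)

theorem labelledAction_fixing (σ : α → Equiv.Perm ι) (c : ι → α → P) {b : ι}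
    {g : FreeGroup α} (hg : g ∈ fixing σ b) (p : P) :
    labelledAction σ c g (b, p) = (b, (labelledAction σ c g (b, 1)).2 * p) := by
  have h := labelledAction_apply_mul_right σ c g (b, 1) p
  rwa [labelledAction_apply_fst, one_mul, mem_fixing.1 hg] at h

/-- The product of the labels along a loop at `b`. -/
def holonomy (σ : α → Equiv.Perm ι) (c : ι → α → P) (b : ι) : fixing σ b →* P :=
  MonoidHom.mk' (fun g => (labelledAction σ c g (b, 1)).2) fun g h => by
    rw [Subgroup.coe_mul, map_mul, Equiv.Perm.mul_apply, labelledAction_fixing σ c h.2,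
      labelledAction_fixing σ c g.2, mul_one]

theorem holonomy_eq {σ : α → Equiv.Perm ι} {c : ι → α → P} {b : ι} {g : fixing σ b} {p : P}
    (h : labelledAction σ c g (b, 1) = (b, p)) : holonomy σ c b g = p :=
  congrArg Prod.snd h

variable {A : Subgroup (FreeGroup α)}

/-- The path in the Schreier graph of `A` that starts at the coset `A` and spells `L`, read from
right to left, stays in `V`. -/
def PathIn (V : Finset (FreeGroup α ⧸ A)) (L : List (α × Bool)) : Prop :=
  ∀ L', L' <:+ L → (mk L' : FreeGroup α ⧸ A) ∈ V

theorem exists_finset_pathIn (A : Subgroup (FreeGroup α)) (W : Finset (FreeGroup α)) :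
    ∃ V : Finset (FreeGroup α ⧸ A), ((1 : FreeGroup α) : FreeGroup α ⧸ A) ∈ V ∧
      (∀ g ∈ W, ∃ L, mk L = g ∧ PathIn V L) ∧
      ∀ v ∈ V, ∃ L, (mk L : FreeGroup α ⧸ A) = v ∧ PathIn V L := by
  classical
  let V : Finset (FreeGroup α ⧸ A) := (insert 1 W).biUnion fun g =>
    g.toWord.tails.toFinset.image fun L => (mk L : FreeGroup α ⧸ A)
  have hV : ∀ g ∈ insert 1 W, PathIn V g.toWord := fun g hg L hL =>
    Finset.mem_biUnion.2 ⟨g, hg, Finset.mem_image.2 ⟨L, by simpa using hL, rfl⟩⟩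
  refine ⟨V, ?_, fun g hg => ⟨_, mk_toWord, hV g (Finset.mem_insert_of_mem hg)⟩, fun v hv => ?_⟩
  · exact hV 1 (Finset.mem_insert_self _ _) [] (List.nil_suffix)
  · obtain ⟨g, hg, hv⟩ := Finset.mem_biUnion.1 hv
    obtain ⟨L, hL, rfl⟩ := Finset.mem_image.1 hv
    exact ⟨L, rfl, fun L' hL' => hV g hg L' (hL'.trans (by simpa using hL))⟩

theorem exists_perm_extending_smul (V : Finset (FreeGroup α ⧸ A)) (g : FreeGroup α) :
    ∃ σ : Equiv.Perm V, ∀ v w : V, g • v.1 = w.1 → σ v = w := by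
  classical
  obtain ⟨σ, hσ⟩ := Set.MapsTo.exists_equiv_extend_of_card_eq (α := V) (t := V)
    (s := {v : V | g • v.1 ∈ V}) (f := fun v => g • v.1) (by simp) (fun v hv => hv)
    (fun v _ w _ h => Subtype.ext (smul_left_cancel g h))
  exact ⟨σ, fun v w h => Subtype.ext ((hσ v (by simp [h])).trans h)⟩

theorem coe_inv_mul_mem {x y : FreeGroup α} (h : (x : FreeGroup α ⧸ A) = y) : x⁻¹ * y ∈ A :=
  QuotientGroup.eq.1 h

/-- Along a path in the part of the Schreier graph where labels come from `A`, the labels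
multiply to the image of the corresponding element of `A`. -/
theorem labelledAction_mk_of_pathIn {V : Finset (FreeGroup α ⧸ A)} {σ : α → Equiv.Perm V}
    (hσ : ∀ a (v w : V), of a • v.1 = w.1 → σ a v = w) {t : V → FreeGroup α}
    (ht : ∀ v, (t v : FreeGroup α ⧸ A) = v) {b : V} (hb : t b = 1) {c : V → α → P}
    {j : A →* P} (hc : ∀ v a (x : A), (t (σ a v))⁻¹ * (of a * t v) = x → c v a = j x)
    {L : List (α × Bool)} (hL : PathIn V L) (v : V) (hv : (mk L : FreeGroup α ⧸ A) = v)
    (x : A) (hx : (t v)⁻¹ * mk L = x) :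
    labelledAction σ c (mk L) (b, 1) = (v, j x) := by
  induction L generalizing v x with
  | nil =>
    have hvb : v = b := Subtype.ext (by rw [← hv, ← ht b, hb]; rfl)
    subst hvb
    rw [← one_eq_mk] at hx ⊢
    have hx1 : x = 1 := Subtype.ext (by simp [← hx, hb])
    rw [hx1, map_one, map_one, Equiv.Perm.one_apply]
  | cons e L ih =>
    have hL' : PathIn V L := fun L' h => hL L' (h.trans (List.suffix_cons e L))
    let w : V := ⟨_, hL' L (List.suffix_refl L)⟩
    let y : A := ⟨(t w)⁻¹ * mk L, coe_inv_mul_mem (ht w)⟩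
    have ihw := ih hL' w rfl y rfl
    obtain ⟨a, _ | _⟩ := e
    · have hm : mk ((a, false) :: L) = (of a)⁻¹ * mk L := by rw [of, inv_mk, mul_mk]; rfl
      rw [hm] at hv hx ⊢
      have hs : σ a v = w := hσ a v w <| by
        rw [← hv]
        exact smul_inv_smul (of a) (mk L : FreeGroup α ⧸ A)
      rw [map_mul, Equiv.Perm.mul_apply, ihw, map_inv, Equiv.Perm.inv_eq_iff_eq,
        labelledAction_of, hs, hc v a (y * x⁻¹) (by simp [← hx, y, hs, mul_assoc, -inv_mk]), ← map_mul,
        inv_mul_cancel_right]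
    · have hm : mk ((a, true) :: L) = of a * mk L := by rw [of, mul_mk]; rfl
      rw [hm] at hv hx ⊢
      have hs : σ a w = v := hσ a w v hv
      rw [map_mul, Equiv.Perm.mul_apply, ihw, labelledAction_of, hs,
        hc w a (x * y⁻¹) (by simp [← hx, y, hs, mul_assoc, -inv_mk]), ← map_mul, inv_mul_cancel_right]

/-- Elements of a subgroup containing all the Schreier generators of `fixing σ b`. -/
theorem inv_mul_mul_mem_of_forall_of {σ : α → Equiv.Perm ι} {t : ι → FreeGroup α}
    {H : Subgroup (FreeGroup α)} (h : ∀ v a, (t (σ a v))⁻¹ * (of a * t v) ∈ H)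
    (g : FreeGroup α) (v : ι) : (t (lift σ g v))⁻¹ * (g * t v) ∈ H := by
  induction g using FreeGroup.induction_on generalizing v with
  | C1 => simp
  | of a => simpa using h v a
  | inv_of a ih =>
    have := H.inv_mem (ih (lift σ (of a)⁻¹ v))
    rw [← Equiv.Perm.mul_apply, ← map_mul, mul_inv_cancel, map_one, Equiv.Perm.one_apply] at this
    simpa [mul_assoc] using this
  | mul g k hg hk => simpa [mul_assoc] using H.mul_mem (hg (lift σ k v)) (hk v)

end SchreierGraph

open SchreierGraph
open FreeGroup hiding map_one map_mul map_inv

/-- (Burns, M. Hall) A finitely generated subgroup `A` of a free group,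
disjoint from a finite set `X`, is a free factor of a finite-index subgroup
`G` disjoint from `X`: there is a subgroup `B` of `G` such that the map
`A ∗ B → G` induced by the inclusions is bijective. -/
theorem exists_finiteIndex_superset_freeFactor {α : Type*}
    (X : Finset (FreeGroup α)) (A : Subgroup (FreeGroup α)) (hA : A.FG)
    (hX : ∀ x ∈ X, x ∉ A) :
    ∃ G : Subgroup (FreeGroup α), G.FiniteIndex ∧ A ≤ G ∧ (∀ x ∈ X, x ∉ G) ∧
      ∃ B : Subgroup G,
        Function.Bijective
          (Coprod.lift (A.subgroupOf G).subtype B.subtype) := by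
  classical
  obtain ⟨S, hS⟩ := (Group.fg_iff_subgroup_fg A).2 hA |>.out
  obtain ⟨V, h1, hW, hV⟩ := exists_finset_pathIn A (X ∪ S.image (fun g : A => (g : FreeGroup α)))
  choose σ hσ using fun a : α => exists_perm_extending_smul V (of a)
  let b : V := ⟨_, h1⟩
  have hpath : ∀ v : V, ∃ L, (mk L : FreeGroup α ⧸ A) = v ∧ PathIn V L ∧ (v = b → mk L = 1) := by
    intro v
    by_cases hvb : v = b
    · subst hvb
      exact ⟨[], rfl, fun L hL => by rw [List.suffix_nil.1 hL]; exact h1, fun _ => rfl⟩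
    · obtain ⟨L, hL⟩ := hV v v.2
      exact ⟨L, hL.1, hL.2, fun h => absurd h hvb⟩
  choose l ht hl hlb using hpath
  let t : V → FreeGroup α := fun v => mk (l v)
  have htb : t b = 1 := hlb b rfl
  let G := fixing σ b
  -- trivial labels record the endpoints of paths
  have hend : ∀ {L : List (α × Bool)}, PathIn V L → ∀ v : V, (mk L : FreeGroup α ⧸ A) = v →
      lift σ (mk L) b = v := fun {L} hL v hv => by
    have := labelledAction_mk_of_pathIn hσ ht htb (c := fun _ _ => (1 : A)) (j := 1)
      (fun _ _ _ _ => rfl) hL v hv ⟨_, coe_inv_mul_mem ((ht v).trans hv.symm)⟩ rfl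
    simpa [labelledAction_apply_fst] using congrArg Prod.fst this
  have htG : ∀ v, lift σ (t v) b = v := fun v => hend (hl v) v (ht v)
  have hsG : ∀ v a, (t (σ a v))⁻¹ * (of a * t v) ∈ G := fun v a => by
    rw [mem_fixing, map_mul, map_mul, map_inv, Equiv.Perm.mul_apply, Equiv.Perm.inv_eq_iff_eq,
      Equiv.Perm.mul_apply, htG, htG, lift_apply_of]
  have hSW : ∀ g ∈ S, ∃ L, mk L = (g : FreeGroup α) ∧ PathIn V L := fun g hg =>
    hW g (Finset.mem_union_right _ (Finset.mem_image_of_mem _ hg))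
  have hSG : ∀ g ∈ S, (g : FreeGroup α) ∈ G := fun g hg => by
    obtain ⟨L, hLg, hL⟩ := hSW g hg
    rw [← hLg]
    refine hend hL b ?_
    rw [hLg]
    exact (QuotientGroup.eq.2 (by simp)).symm
  have hAG : A ≤ G := by
    have : (⊤ : Subgroup A) ≤ G.comap A.subtype := by
      rw [← hS, Subgroup.closure_le]
      exact hSG
    exact fun g hg => this (Subgroup.mem_top (⟨g, hg⟩ : A))
  refine ⟨G, inferInstanceAs (fixing σ b).FiniteIndex, hAG, fun x hx hxG => ?_, ?_⟩
  · obtain ⟨L, rfl, hL⟩ := hW x (by simp [hx])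
    have h := hend hL ⟨_, hL L (List.suffix_refl L)⟩ rfl
    rw [mem_fixing.1 hxG] at h
    have h' : ((1 : FreeGroup α) : FreeGroup α ⧸ A) = mk L := congrArg Subtype.val h
    exact hX _ hx (by simpa using QuotientGroup.eq.1 h')
  let s : V → α → G := fun v a => ⟨_, hsG v a⟩
  let B : Subgroup G := Subgroup.closure {g | ∃ v a, (s v a : FreeGroup α) ∉ A ∧ s v a = g}
  have hsB : ∀ v a, (s v a : FreeGroup α) ∉ A → s v a ∈ B := fun v a h =>
    Subgroup.subset_closure ⟨v, a, h, rfl⟩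
  refine ⟨B, ?_, ?_⟩
  · let j : A →* Coprod (A.subgroupOf G) B :=
      Coprod.inl.comp (Subgroup.subgroupOfEquivOfLe hAG).symm.toMonoidHom
    let c : V → α → Coprod (A.subgroupOf G) B := fun v a =>
      if h : (s v a : FreeGroup α) ∈ A then j ⟨_, h⟩ else Coprod.inr ⟨s v a, hsB v a h⟩
    have hc : ∀ v a (x : A), (t (σ a v))⁻¹ * (of a * t v) = x → c v a = j x := by
      rintro v a ⟨x, hx⟩ rfl
      exact dif_pos hx
    have htc : ∀ v, labelledAction σ c (t v) (b, 1) = (v, 1) := fun v => by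
      have h := labelledAction_mk_of_pathIn hσ ht htb hc (hl v) v (ht v) 1 (inv_mul_cancel (t v))
      rwa [map_one] at h
    have hψs : ∀ v a, holonomy σ c b (s v a) = c v a := fun v a => by
      apply holonomy_eq
      have h := labelledAction_apply_mul_right σ c (t (σ a v)) (b, 1) (c v a)
      rw [htc] at h
      simp only [one_mul] at h
      change labelledAction σ c ((t (σ a v))⁻¹ * (of a * t v)) (b, 1) = _
      rw [map_mul, map_mul, map_inv, Equiv.Perm.mul_apply, Equiv.Perm.inv_eq_iff_eq,
        Equiv.Perm.mul_apply, htc, h, labelledAction_of, mul_one]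
    have hψA : (holonomy σ c b).comp (Subgroup.inclusion hAG) = j := by
      refine MonoidHom.eq_of_eqOn_dense hS fun g hg => holonomy_eq ?_
      obtain ⟨L, hLg, hL⟩ := hSW g hg
      change labelledAction σ c g (b, 1) = _
      rw [← hLg]
      refine labelledAction_mk_of_pathIn hσ ht htb hc hL b ?_ g ?_
      · rw [hLg]
        exact (QuotientGroup.eq.2 (by simp)).symm
      · change (t b)⁻¹ * mk L = g
        rw [htb, inv_one, one_mul, hLg]
    have hψ : (holonomy σ c b).comp (Coprod.lift (A.subgroupOf G).subtype B.subtype) =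
        MonoidHom.id _ := by
      refine Coprod.hom_ext ?_ ?_
      · ext g
        exact DFunLike.congr_fun hψA ⟨g, g.2⟩
      · refine MonoidHom.eq_of_eqOn_dense (Subgroup.closure_closure_coe_preimage) ?_
        rintro ⟨_, _⟩ ⟨v, a, h, rfl⟩
        exact (hψs v a).trans (dif_neg h)
    exact Function.LeftInverse.injective (g := holonomy σ c b) fun x => DFunLike.congr_fun hψ x
  · rw [← MonoidHom.range_eq_top, Coprod.range_lift, Subgroup.range_subtype,
      Subgroup.range_subtype, eq_top_iff]
    intro g _
    have h := inv_mul_mul_mem_of_forall_of (σ := σ) (t := t)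
      (H := (A.subgroupOf G ⊔ B).map G.subtype) (fun v a => ⟨s v a, ?_, rfl⟩) g b
    · rw [mem_fixing.1 g.2, htb] at h
      simpa using h
    · by_cases hs : (s v a : FreeGroup α) ∈ A
      · exact Subgroup.mem_sup_left hs
      · exact Subgroup.mem_sup_right (hsB v a hs)
end

section
/- Let F be a free group and let A be a finitely generated subgroup of F. Then A equals the intersection of all finite-index subgroups of F containing A; that is, A = ⋂ {G : G is a subgroup of F of finite index with A ≤ G}. -/
/-- The restriction of a permutation to a finite set, as a partial map, extends to a permutation
of that set. -/
theorem Equiv.Perm.exists_perm_finset_extend {X : Type*} (S : Finset X) (f : Equiv.Perm X) :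
    ∃ σ : Equiv.Perm S, ∀ s : S, f s ∈ S → (σ s : X) = f s :=
  Set.MapsTo.exists_equiv_extend_of_card_eq (s := {s : S | f s ∈ S}) (f := fun s => f s)
    (Fintype.card_coe S) (fun _ hs => hs) (fun _ _ _ _ h => Subtype.ext (f.injective h))

namespace FreeGroup

variable {α X : Type*} [MulAction (FreeGroup α) X]

/-- For every finite subset `S` of a `FreeGroup α`-set there is an action on `S` which agrees with
the given one along every word whose path from `x` stays inside `S`. -/
theorem exists_hom_perm_finset_s8 (S : Finset X) :
    ∃ φ : FreeGroup α →* Equiv.Perm S, ∀ (x : S) (L : List (α × Bool)),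
      (∀ L', L' <:+ L → mk L' • (x : X) ∈ S) → (φ (mk L) x : X) = mk L • (x : X) := by
  choose σ hσ using fun a : α =>
    Equiv.Perm.exists_perm_finset_extend S (MulAction.toPerm (of a : FreeGroup α))
  refine ⟨lift σ, fun x L => ?_⟩
  induction L with
  | nil => simp [← one_eq_mk]
  | cons p L ih =>
    intro h
    have hL := ih fun L' hL' => h L' (hL'.trans (List.suffix_cons p L))
    have hS := h _ List.suffix_rfl
    obtain ⟨a, b⟩ := p
    have hmk : mk ((a, b) :: L) = mk [(a, b)] * mk L := by simp
    rw [hmk, mul_smul, ← hL] at hS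
    rw [hmk, _root_.map_mul, Equiv.Perm.mul_apply, mul_smul, ← hL]
    generalize lift σ (mk L) x = y at hS ⊢
    cases b with
    | true => simpa [of] using hσ a y hS
    | false =>
      have hinv : (mk [(a, false)] : FreeGroup α) = (of a)⁻¹ := by simp [of, invRev]
      rw [hinv] at hS ⊢
      have key : σ a ⟨(of a)⁻¹ • (y : X), hS⟩ = y :=
        Subtype.ext <| by simpa using hσ a ⟨(of a)⁻¹ • (y : X), hS⟩ (by simp)
      rw [_root_.map_inv, lift_apply_of, Equiv.Perm.inv_eq_iff_eq.mpr key.symm]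

/-- A finitely generated subgroup of a free group can be separated from any element outside it by
a subgroup of finite index. -/
theorem exists_finiteIndex_notMem {A : Subgroup (FreeGroup α)} (hA : A.FG) {w : FreeGroup α}
    (hw : w ∉ A) : ∃ G : Subgroup (FreeGroup α), G.FiniteIndex ∧ A ≤ G ∧ w ∉ G := by
  classical
  obtain ⟨T, rfl⟩ := hA
  set A := Subgroup.closure (T : Set (FreeGroup α))
  let x₀ : FreeGroup α ⧸ A := ((1 : FreeGroup α) : FreeGroup α ⧸ A)
  let S : Finset (FreeGroup α ⧸ A) :=
    (insert w T).biUnion fun g => (g.toWord.tails.map fun L => mk L • x₀).toFinset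
  have hS : ∀ g ∈ insert w T, ∀ L, L <:+ g.toWord → mk L • x₀ ∈ S := fun g hg L hL =>
    Finset.mem_biUnion.mpr ⟨g, hg, List.mem_toFinset.mpr
      (List.mem_map.mpr ⟨L, (List.mem_tails L _).mpr hL, rfl⟩)⟩
  have hx₀ : x₀ ∈ S := by
    simpa [← one_eq_mk] using hS w (Finset.mem_insert_self w T) [] List.nil_suffix
  have hfix : ∀ g : FreeGroup α, g • x₀ = x₀ ↔ g ∈ A := fun g => by
    rw [← MulAction.mem_stabilizer_iff, MulAction.stabilizer_quotient]
  obtain ⟨φ, hφ⟩ := exists_hom_perm_finset_s8 (α := α) S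
  have hφS : ∀ g ∈ insert w T, (φ g ⟨x₀, hx₀⟩ : FreeGroup α ⧸ A) = g • x₀ := fun g hg => by
    simpa only [mk_toWord] using hφ ⟨x₀, hx₀⟩ g.toWord (hS g hg)
  refine ⟨(MulAction.stabilizer (Equiv.Perm S) (⟨x₀, hx₀⟩ : S)).comap φ,
    ⟨by rw [Subgroup.index_comap]; exact Subgroup.FiniteIndex.index_ne_zero⟩,
    (Subgroup.closure_le _).mpr fun g hg => ?_, fun h => hw ?_⟩
  · exact Subtype.ext <| (hφS g (Finset.mem_insert_of_mem hg)).trans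
      ((hfix g).mpr (Subgroup.subset_closure hg))
  · exact (hfix w).mp <| (hφS w (Finset.mem_insert_self w T)).symm.trans (congrArg Subtype.val h)

end FreeGroup

/-- A finitely generated subgroup of a free group is the intersection of the
finite-index subgroups containing it. -/
theorem eq_sInf_finiteIndex_superset {α : Type*}
    (A : Subgroup (FreeGroup α)) (hA : A.FG) :
    A = sInf {G : Subgroup (FreeGroup α) | G.FiniteIndex ∧ A ≤ G} := by
  refine le_antisymm (le_sInf fun G hG => hG.2) fun w hw => ?_
  by_contra hwA
  obtain ⟨G, hG, hAG, hwG⟩ := FreeGroup.exists_finiteIndex_notMem hA hwA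
  exact hwG (Subgroup.mem_sInf.mp hw G ⟨hG, hAG⟩)
end
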